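/- Under the stated hypotheses, the function u satisfies the boundary and smooth-fit conditions: u(p) → 0 as p → 0⁺, u(p) → M as p → b⁻, and u′(p) → 0 as p → b⁻. -/

import Mathlib

/-- The standard normal density `φ(z) = exp(-z²/2)/√(2π)`. -/
noncomputable def npdf (z : ℝ) : ℝ := (Real.sqrt (2 * Real.pi))⁻¹ * Real.exp (-z ^ 2 / 2)

/-- The standard normal distribution function `Φ(y) = ∫_{-∞}^y φ(z) dz`. -/
noncomputable def ncdf (y : ℝ) : ℝ := ∫ z in Set.Iic y, npdf z

/-- The standard normal tail function `Ψ(y) = 1 - Φ(y)`. -/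
noncomputable def ntail (y : ℝ) : ℝ := 1 - ncdf y

/-- The function `F(y) = φ(y) - y·Ψ(y)`. -/
noncomputable def Fstat (y : ℝ) : ℝ := npdf y - y * ntail y

lemma npdf_eq : npdf = ProbabilityTheory.gaussianPDFReal 0 1 := by
  funext z
  simp [npdf, ProbabilityTheory.gaussianPDFReal]

lemma npdf_int : MeasureTheory.Integrable npdf := by
  rw [npdf_eq]; exact ProbabilityTheory.integrable_gaussianPDFReal 0 1

lemma npdf_total : ∫ z, npdf z = 1 := by
  rw [npdf_eq]; exact ProbabilityTheory.integral_gaussianPDFReal_eq_one 0 one_ne_zero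

lemma npdf_cont : Continuous npdf := by unfold npdf; fun_prop

lemma npdf_pos (z : ℝ) : 0 < npdf z := by
  have := Real.pi_pos
  unfold npdf; positivity

lemma npdf_deriv (z : ℝ) : HasDerivAt npdf (-z * npdf z) z := by
  have h1 : HasDerivAt (fun z : ℝ => -z ^ 2 / 2) (-z) z := by
    have := (((hasDerivAt_id z).pow 2).neg).div_const 2
    refine this.congr_deriv ?_
    simp
    ring
  have h2 := (h1.exp).const_mul ((Real.sqrt (2 * Real.pi))⁻¹)
  refine h2.congr_deriv ?_
  unfold npdf; ring

lemma ncdf_deriv (y : ℝ) : HasDerivAt ncdf (npdf y) y := by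
  have h : ncdf = fun y => ncdf 0 + ∫ z in (0:ℝ)..y, npdf z := by
    funext y
    rw [← intervalIntegral.integral_Iic_sub_Iic npdf_int.integrableOn npdf_int.integrableOn]
    simp [ncdf]
  rw [h]
  exact (intervalIntegral.integral_hasDerivAt_right (npdf_cont.intervalIntegrable _ _)
    (npdf_cont.stronglyMeasurableAtFilter _ _) npdf_cont.continuousAt).const_add _

lemma ntail_deriv (y : ℝ) : HasDerivAt ntail (-npdf y) y := (ncdf_deriv y).const_sub 1

lemma ntail_cont : Continuous ntail :=
  continuous_iff_continuousAt.2 fun y => (ntail_deriv y).continuousAt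

lemma ntail_anti : StrictAnti ntail :=
  strictAnti_of_deriv_neg fun y => by
    rw [(ntail_deriv y).deriv]; linarith [npdf_pos y]

lemma ntail_lim : Filter.Tendsto ntail Filter.atTop (nhds 0) := by
  have h : Filter.Tendsto ncdf Filter.atTop (nhds 1) := by
    rw [← npdf_total]
    exact (MeasureTheory.aecover_Iic Filter.tendsto_id).integral_tendsto_of_countably_generated
      npdf_int
  have h2 := h.const_sub 1
  rw [sub_self] at h2
  exact h2

lemma ntail_pos (y : ℝ) : 0 < ntail y := by
  have h1 : ntail (y + 1) < ntail y := ntail_anti (by linarith)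
  have h2 : 0 ≤ ntail (y + 1) := ntail_anti.antitone.le_of_tendsto ntail_lim _
  linarith

lemma ntail_zero : ntail 0 = 1 / 2 := by
  have h1 : ncdf 0 = ∫ z in Set.Ioi (0:ℝ), npdf z := by
    have := integral_comp_neg_Iic (0:ℝ) npdf
    rw [neg_zero] at this
    rw [← this]
    unfold ncdf
    congr 1
    funext z
    simp [npdf]
  have h2 : ncdf 0 + ∫ z in Set.Ioi (0:ℝ), npdf z = 1 := by
    rw [← npdf_total]
    exact intervalIntegral.integral_Iic_add_Ioi npdf_int.integrableOn npdf_int.integrableOn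
  unfold ntail
  linarith

lemma mul_npdf_lim : Filter.Tendsto (fun y => y * npdf y) Filter.atTop (nhds 0) := by
  have h := (Real.tendsto_pow_mul_exp_neg_atTop_nhds_zero 1).const_mul
    ((Real.sqrt (2 * Real.pi))⁻¹)
  rw [mul_zero] at h
  refine squeeze_zero' ?_ ?_ h
  · filter_upwards [Filter.eventually_ge_atTop 0] with y hy
    exact mul_nonneg hy (npdf_pos y).le
  · filter_upwards [Filter.eventually_ge_atTop 2] with y hy
    have : Real.exp (-y ^ 2 / 2) ≤ Real.exp (-y) := Real.exp_le_exp.2 (by nlinarith)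
    have h3 : 0 ≤ (Real.sqrt (2 * Real.pi))⁻¹ * y := by positivity
    have := mul_le_mul_of_nonneg_left this h3
    unfold npdf
    rw [pow_one]
    linarith

lemma npdf_lim : Filter.Tendsto npdf Filter.atTop (nhds 0) := by
  refine squeeze_zero' ?_ ?_ mul_npdf_lim
  · filter_upwards with y using (npdf_pos y).le
  · filter_upwards [Filter.eventually_ge_atTop 1] with y hy
    nlinarith [npdf_pos y]

lemma ntail_le (y : ℝ) (hy : 1 ≤ y) : ntail y ≤ npdf y := by
  have hd : ∀ x, HasDerivAt (fun x => npdf x - ntail x) (-x * npdf x - -npdf x) x :=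
    fun x => (npdf_deriv x).sub (ntail_deriv x)
  have ha : AntitoneOn (fun x => npdf x - ntail x) (Set.Ici 1) := by
    refine antitoneOn_of_deriv_nonpos (convex_Ici 1) ?_ ?_ ?_
    · exact (npdf_cont.sub ntail_cont).continuousOn
    · exact fun x _ => (hd x).differentiableAt.differentiableWithinAt
    · intro x hx
      rw [interior_Ici] at hx
      rw [(hd x).deriv]
      have : 1 < x := hx
      nlinarith [npdf_pos x]
  have hl : Filter.Tendsto (fun x => npdf x - ntail x) Filter.atTop (nhds 0) := by
    simpa using npdf_lim.sub ntail_lim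
  have : 0 ≤ npdf y - ntail y := by
    refine le_of_tendsto hl ?_
    filter_upwards [Filter.eventually_ge_atTop y] with x hx
    exact ha hy (le_trans hy hx) hx
  linarith

lemma mul_ntail_lim : Filter.Tendsto (fun y => y * ntail y) Filter.atTop (nhds 0) := by
  refine squeeze_zero' ?_ ?_ mul_npdf_lim
  · filter_upwards [Filter.eventually_ge_atTop 0] with y hy
    exact mul_nonneg hy (ntail_pos y).le
  · filter_upwards [Filter.eventually_ge_atTop 1] with y hy
    exact mul_le_mul_of_nonneg_left (ntail_le y hy) (by linarith)

lemma Fstat_lim : Filter.Tendsto Fstat Filter.atTop (nhds 0) := by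
  have h2 := npdf_lim.sub mul_ntail_lim
  rw [sub_self] at h2
  exact h2

lemma Fstat_cont : Continuous Fstat := npdf_cont.sub (continuous_id.mul ntail_cont)

lemma Fstat_deriv (y : ℝ) : HasDerivAt Fstat (-ntail y) y := by
  refine ((npdf_deriv y).sub ((hasDerivAt_id y).mul (ntail_deriv y))).congr_deriv ?_
  simp

lemma tendsto_of_ntail {l : Filter ℝ} {w : ℝ → ℝ} {y₀ : ℝ}
    (h : Filter.Tendsto (fun p => ntail (w p)) l (nhds (ntail y₀))) :
    Filter.Tendsto w l (nhds y₀) := by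
  rw [tendsto_order] at h ⊢
  refine ⟨fun a ha => ?_, fun a ha => ?_⟩
  · filter_upwards [h.2 _ (ntail_anti ha)] with p hp using ntail_anti.lt_iff_gt.1 hp
  · filter_upwards [h.1 _ (ntail_anti ha)] with p hp using ntail_anti.lt_iff_gt.1 hp

lemma tendsto_atTop_of_ntail {l : Filter ℝ} {w : ℝ → ℝ}
    (h : Filter.Tendsto (fun p => ntail (w p)) l (nhds 0)) :
    Filter.Tendsto w l Filter.atTop := by
  rw [Filter.tendsto_atTop]
  intro A
  filter_upwards [(tendsto_order.1 h).2 _ (ntail_pos A)] with p hp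
  exact (ntail_anti.lt_iff_gt.1 hp).le

/-- boundary and smooth-fit conditions for u:
u(p) → 0 as p → 0+, u(p) → M as p → b−, and u′(p) → 0 as p → b−. -/
theorem u_boundary (r M b : ℝ) (v u : ℝ → ℝ) (hr : 0 < r) (hM : 0 < M)
    (hMle : M ≤ Real.sqrt Real.pi / (2 * Real.sqrt r))
    (hb : b = M * Real.pi * Real.sqrt r / (Real.sqrt Real.pi + 2 * M * Real.sqrt r))
    (hv : ∀ p ∈ Set.Ioo (0:ℝ) b, 0 < v p ∧
      ntail (Real.sqrt (2*r) * v p) = (1 - b) * p / (2 * b * (1 - p)))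
    (hu : ∀ p ∈ Set.Ioo (0:ℝ) b, u p =
      p * v p + M * Real.sqrt (2 * Real.pi) * ((1 - p) / (1 - b))
        * Fstat (Real.sqrt (2*r) * v p)) :
    Filter.Tendsto u (nhdsWithin 0 (Set.Ioo 0 b)) (nhds 0) ∧
    Filter.Tendsto u (nhdsWithin b (Set.Ioo 0 b)) (nhds M) ∧
    Filter.Tendsto (deriv u) (nhdsWithin b (Set.Ioo 0 b)) (nhds 0) := by
  have hpi := Real.pi_pos
  have hsr : 0 < Real.sqrt r := Real.sqrt_pos.2 hr
  have hsp : 0 < Real.sqrt Real.pi := Real.sqrt_pos.2 hpi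
  have hx : 2 * M * Real.sqrt r ≤ Real.sqrt Real.pi := by
    rw [le_div_iff₀ (by positivity)] at hMle; linarith
  have hb0 : 0 < b := by rw [hb]; positivity
  have hb1 : b < 1 := by
    rw [hb, div_lt_one (by positivity)]
    have h4 := Real.pi_lt_four
    have : 0 < M * Real.sqrt r := by positivity
    nlinarith
  have hkey : M * Real.pi / (2 * b) = Real.sqrt Real.pi / (2 * Real.sqrt r) + M := by
    rw [hb]; field_simp
  clear hMle hx hb
  have hs : 0 < Real.sqrt (2 * r) := Real.sqrt_pos.2 (by linarith)
  have ht : 0 < Real.sqrt (2 * Real.pi) := Real.sqrt_pos.2 (by linarith)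
  have hss : Real.sqrt (2 * r) = Real.sqrt 2 * Real.sqrt r := Real.sqrt_mul (by norm_num) _
  have htt : Real.sqrt (2 * Real.pi) = Real.sqrt 2 * Real.sqrt Real.pi :=
    Real.sqrt_mul (by norm_num) _
  set s := Real.sqrt (2 * r) with hsdef
  set t := Real.sqrt (2 * Real.pi) with htdef
  obtain ⟨w, hw⟩ : ∃ w : ℝ → ℝ, ∀ p, w p = s * v p := ⟨_, fun _ => rfl⟩
  obtain ⟨q, hq⟩ : ∃ q : ℝ → ℝ, ∀ p, q p = (1 - b) * p / (2 * b * (1 - p)) := ⟨_, fun _ => rfl⟩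
  have hwq : ∀ p ∈ Set.Ioo (0:ℝ) b, ntail (w p) = q p := fun p hp => by
    rw [hw, hq]; exact (hv p hp).2
  have hu' : ∀ p ∈ Set.Ioo (0:ℝ) b,
      u p = p * w p / s + M * t * ((1 - p) / (1 - b)) * Fstat (w p) := fun p hp => by
    rw [hu p hp, hw]; field_simp
  have hqd : ∀ p, p < 1 → HasDerivAt q ((1 - b) / (2 * b) / (1 - p) ^ 2) p := by
    intro p hp
    have hne : 1 - p ≠ 0 := by linarith
    have hq' : q = fun p => (1 - b) * p / (2 * b * (1 - p)) := funext hq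
    rw [hq']
    have h1 := ((hasDerivAt_id p).const_mul (1 - b)).div
      (((hasDerivAt_id p).const_sub 1).const_mul (2 * b)) (by simp; exact ⟨hb0.ne', hne⟩)
    refine h1.congr_deriv ?_
    simp only [id]
    field_simp
    ring
  have hnpdf0 : npdf 0 = t⁻¹ := by simp [npdf, htdef]
  have hmem : ∀ a : ℝ, ∀ᶠ p in nhdsWithin a (Set.Ioo 0 b), p ∈ Set.Ioo (0:ℝ) b :=
    fun a => eventually_mem_nhdsWithin
  have hid : ∀ a : ℝ, Filter.Tendsto (fun p : ℝ => p) (nhdsWithin a (Set.Ioo 0 b)) (nhds a) :=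
    fun a => tendsto_nhdsWithin_of_tendsto_nhds Filter.tendsto_id
  have hnt : ∀ a : ℝ, a < 1 → Filter.Tendsto (fun p => ntail (w p))
      (nhdsWithin a (Set.Ioo 0 b)) (nhds (q a)) := by
    intro a ha
    have h1 : Filter.Tendsto q (nhdsWithin a (Set.Ioo 0 b)) (nhds (q a)) :=
      (hqd a ha).continuousAt.tendsto.mono_left nhdsWithin_le_nhds
    refine h1.congr' ?_
    filter_upwards [hmem a] with p hp using (hwq p hp).symm
  have hqb : q b = ntail 0 := by
    have : 1 - b ≠ 0 := by linarith
    rw [hq, ntail_zero]; field_simp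
  have hwb : Filter.Tendsto w (nhdsWithin b (Set.Ioo 0 b)) (nhds 0) := by
    apply tendsto_of_ntail
    rw [← hqb]; exact hnt b hb1
  have h1b : 1 - b ≠ 0 := by linarith
  have hFb : Filter.Tendsto (fun p => Fstat (w p)) (nhdsWithin b (Set.Ioo 0 b)) (nhds t⁻¹) := by
    have := (Fstat_cont.tendsto 0).comp hwb
    simpa [Fstat, hnpdf0, Function.comp_def] using this
  refine ⟨?_, ?_, ?_⟩
  · have hw0 : Filter.Tendsto w (nhdsWithin 0 (Set.Ioo 0 b)) Filter.atTop := by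
      apply tendsto_atTop_of_ntail
      have := hnt 0 one_pos
      simpa [hq] using this
    have hF0 := Fstat_lim.comp hw0
    have hm0 := mul_ntail_lim.comp hw0
    have hA : Filter.Tendsto (fun p => (2 * b * (1 - p)) / ((1 - b) * s) * (w p * ntail (w p))
        + M * t * ((1 - p) / (1 - b)) * Fstat (w p)) (nhdsWithin 0 (Set.Ioo 0 b))
        (nhds ((2 * b * (1 - 0)) / ((1 - b) * s) * 0 + M * t * ((1 - 0) / (1 - b)) * 0)) := by
      refine Filter.Tendsto.add (Filter.Tendsto.mul ?_ hm0) (Filter.Tendsto.mul ?_ hF0)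
      · exact (((hid 0).const_sub 1).const_mul _).div_const _
      · exact (((hid 0).const_sub 1).div_const _).const_mul _
    simp only [mul_zero, add_zero] at hA
    refine hA.congr' ?_
    filter_upwards [hmem 0] with p hp
    have : 1 - p ≠ 0 := by linarith [hp.2]
    rw [hu' p hp, hwq p hp, hq]
    field_simp
  · have hA : Filter.Tendsto (fun p => p * w p / s + M * t * ((1 - p) / (1 - b)) * Fstat (w p))
        (nhdsWithin b (Set.Ioo 0 b))
        (nhds (b * 0 / s + M * t * ((1 - b) / (1 - b)) * t⁻¹)) := by
      refine Filter.Tendsto.add (((hid b).mul hwb).div_const _) (Filter.Tendsto.mul ?_ hFb)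
      exact (((hid b).const_sub 1).div_const _).const_mul _
    have e : b * 0 / s + M * t * ((1 - b) / (1 - b)) * t⁻¹ = M := by field_simp; ring
    rw [e] at hA
    refine hA.congr' ?_
    filter_upwards [hmem b] with p hp using (hu' p hp).symm
  · -- derivative of w
    have hwd : ∀ p ∈ Set.Ioo (0:ℝ) b,
        HasDerivAt w ((1 - b) / (2 * b) / (1 - p) ^ 2 * (-npdf (w p))⁻¹) p := by
      intro p hp
      have hp1 : p < 1 := hp.2.trans hb1
      have hnhds : nhdsWithin p (Set.Ioo 0 b) = nhds p := isOpen_Ioo.nhdsWithin_eq hp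
      have hc : ContinuousAt w p := by
        apply tendsto_of_ntail
        have := hnt p hp1
        rwa [hnhds, ← hwq p hp] at this
      have hev : ∀ᶠ x in nhds p, ntail (w x) = q x := by
        filter_upwards [isOpen_Ioo.mem_nhds hp] with x hx using hwq x hx
      have hne : -npdf (w p) ≠ 0 := by linarith [npdf_pos (w p)]
      have h := HasDerivAt.of_comp_left hc (ntail_deriv (w p)) (hqd p hp1) hne hev
      rwa [div_eq_mul_inv _ (-npdf (w p))] at h
    have hud : ∀ p ∈ Set.Ioo (0:ℝ) b, deriv u p =
        (w p + p * ((1 - b) / (2 * b) / (1 - p) ^ 2 * (-npdf (w p))⁻¹)) / s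
        + (-(M * t / (1 - b)) * Fstat (w p) + M * t * ((1 - p) / (1 - b)) *
          (-ntail (w p) * ((1 - b) / (2 * b) / (1 - p) ^ 2 * (-npdf (w p))⁻¹))) := by
      intro p hp
      have hF := (Fstat_deriv (w p)).comp p (hwd p hp)
      have h1 := ((hasDerivAt_id p).mul (hwd p hp)).div_const s
      have h2 := ((((hasDerivAt_id p).const_sub 1).div_const (1 - b)).const_mul (M * t)).mul hF
      have h3 : HasDerivAt u _ p := (h1.add h2).congr_of_eventuallyEq (by
        filter_upwards [isOpen_Ioo.mem_nhds hp] with x hx using hu' x hx)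
      rw [h3.deriv]
      simp only [id, Function.comp]
      ring
    have hnb : Filter.Tendsto (fun p => (-npdf (w p))⁻¹) (nhdsWithin b (Set.Ioo 0 b))
        (nhds (-t)) := by
      have := (npdf_cont.tendsto 0).comp hwb
      rw [hnpdf0] at this
      have h2 := this.neg.inv₀ (by simp; exact ht.ne')
      simpa [inv_neg] using h2
    have hW : Filter.Tendsto (fun p => (1 - b) / (2 * b) / (1 - p) ^ 2 * (-npdf (w p))⁻¹)
        (nhdsWithin b (Set.Ioo 0 b)) (nhds ((1 - b) / (2 * b) / (1 - b) ^ 2 * (-t))) :=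
      (tendsto_const_nhds.div (((hid b).const_sub 1).pow 2) (by positivity)).mul hnb
    have hA := (((hwb.add ((hid b).mul hW)).div_const s)).add
      ((hFb.const_mul (-(M * t / (1 - b)))).add
        (((((hid b).const_sub 1).div_const (1 - b)).const_mul (M * t)).mul
          ((hnt b hb1).neg.mul hW)))
    have e : (0 + b * ((1 - b) / (2 * b) / (1 - b) ^ 2 * (-t))) / s
        + (-(M * t / (1 - b)) * t⁻¹ + M * t * ((1 - b) / (1 - b)) *
          (-q b * ((1 - b) / (2 * b) / (1 - b) ^ 2 * (-t)))) = 0 := by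
      rw [hqb, ntail_zero]
      have ht2 : t ^ 2 = 2 * Real.pi := Real.sq_sqrt (by positivity)
      have hts : t / s = Real.sqrt Real.pi / Real.sqrt r := by
        rw [hss, htt]; field_simp
      have e1 : (0 + b * ((1 - b) / (2 * b) / (1 - b) ^ 2 * (-t))) / s
        + (-(M * t / (1 - b)) * t⁻¹ + M * t * ((1 - b) / (1 - b)) *
          (-(1 / 2) * ((1 - b) / (2 * b) / (1 - b) ^ 2 * (-t))))
          = (-(t / s) / 2 - M + M * t ^ 2 / (4 * b)) / (1 - b) := by
        field_simp; ring
      rw [e1, ht2, hts]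
      have e2 : M * (2 * Real.pi) / (4 * b) = M * Real.pi / (2 * b) := by field_simp; ring
      rw [e2, hkey]
      field_simp; ring
    rw [e] at hA
    refine hA.congr' ?_
    filter_upwards [hmem b] with p hp using (hud p hp).symm
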